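/- arXiv:2006.08059 — 2 statements merged into one kernel-verified Lean document; each statement's English description precedes it below -/
import Mathlib

section
/- The twisted torus T₋ is nonempty; that is, there exists a function g : Γ → ℂˣ satisfying g(γ₁+γ₂) = (-1)^⟨γ₁,γ₂⟩ g(γ₁) g(γ₂) for all γ₁, γ₂ ∈ Γ. -/
/-- On a free module, every alternating bilinear form is the antisymmetrization of a
bilinear form. -/
theorem LinearMap.IsAlt.exists_eq_sub_flip {R M : Type*} [CommRing R] [AddCommGroup M]
    [Module R M] [Module.Free R M] {B : M →ₗ[R] M →ₗ[R] R} (hB : B.IsAlt) :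
    ∃ A : M →ₗ[R] M →ₗ[R] R, B = A - A.flip := by
  classical
  let b := Module.Free.chooseBasis R M
  let _ : LinearOrder (Module.Free.ChooseBasisIndex R M) :=
    IsWellOrder.linearOrder WellOrderingRel
  refine ⟨b.constr R fun i => b.constr R fun j => if i < j then B (b i) (b j) else 0, ?_⟩
  refine b.ext fun i => b.ext fun j => ?_
  simp only [LinearMap.sub_apply, LinearMap.flip_apply, Module.Basis.constr_basis]
  rcases lt_trichotomy i j with h | rfl | h
  · simp [h, h.not_gt]
  · simp [hB.self_eq_zero]
  · simp [h, h.not_gt, hB.neg]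

/-- The twisted torus `T₋` associated to a free `ℤ`-module of finite rank `Γ` with an
alternating bilinear form `B` is nonempty: there exists `g : Γ → ℂˣ` with
`g (γ₁ + γ₂) = (-1) ^ B γ₁ γ₂ * g γ₁ * g γ₂` for all `γ₁ γ₂`. -/
theorem twisted_torus_nonempty {Γ : Type*} [AddCommGroup Γ]
    [Module.Free ℤ Γ] [Module.Finite ℤ Γ]
    (B : Γ →ₗ[ℤ] Γ →ₗ[ℤ] ℤ) (hBalt : ∀ γ, B γ γ = 0) :
    ∃ g : Γ → ℂˣ, ∀ γ₁ γ₂, g (γ₁ + γ₂) = (-1 : ℂˣ) ^ (B γ₁ γ₂) * g γ₁ * g γ₂ := by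
  obtain ⟨A, rfl⟩ := LinearMap.IsAlt.exists_eq_sub_flip (B := B) hBalt
  refine ⟨fun γ => (-1) ^ A γ γ, fun x y => ?_⟩
  have hq : A (x + y) (x + y) = (A - A.flip) x y + A x x + A y y + 2 * A y x := by
    simp only [map_add, LinearMap.add_apply, LinearMap.sub_apply, LinearMap.flip_apply]
    ring
  simp only [hq, zpow_add, (even_two_mul (A y x)).neg_one_zpow, mul_one]
end

section
/- Let γ ∈ Γ, Ω ∈ ℤ, and let g be an element of the twisted torus T₋ with g(γ) ≠ 1. Then S_{γ,Ω}(g)(γ) = g(γ), so that S_{γ,−Ω} is defined at the point S_{γ,Ω}(g), and moreover S_{γ,−Ω}(S_{γ,Ω}(g)) = g. In particular, the transformations S_{γ,Ω} and S_{γ,−Ω} are mutually inverse where defined, so S_{γ,Ω} is a birational automorphism of the twisted torus. -/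
/-- The Kontsevich–Soibelman transformation attached to a class `γ ∈ Γ` and an
integer `Ω`, defined on the set of points `g` of the twisted torus with `g γ ≠ 1` by
`S_{γ,Ω}(g)(β) = g β * (1 - g γ) ^ (Ω * ⟨β, γ⟩)`. -/
noncomputable def KS {Γ : Type*} [AddCommGroup Γ]
    (B : Γ →ₗ[ℤ] Γ →ₗ[ℤ] ℤ) (γ : Γ) (Ω : ℤ) (g : Γ → ℂˣ)
    (h : (1 : ℂ) - (g γ : ℂ) ≠ 0) : Γ → ℂˣ :=
  fun β => g β * (Units.mk0 ((1 : ℂ) - (g γ : ℂ)) h) ^ (Ω * B β γ)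

/-- `S_{γ,Ω}(g)(γ) = g γ`, so `S_{γ,-Ω}` is defined at `S_{γ,Ω}(g)`, and
`S_{γ,-Ω}(S_{γ,Ω}(g)) = g`: the transformations `S_{γ,Ω}` and `S_{γ,-Ω}` are
mutually inverse where defined. -/
theorem KS_inverse {Γ : Type*} [AddCommGroup Γ]
    [Module.Free ℤ Γ] [Module.Finite ℤ Γ]
    (B : Γ →ₗ[ℤ] Γ →ₗ[ℤ] ℤ) (hBalt : ∀ γ, B γ γ = 0)
    (γ : Γ) (Ω : ℤ) (g : Γ → ℂˣ)
    (hg : ∀ γ₁ γ₂, g (γ₁ + γ₂) = (-1 : ℂˣ) ^ (B γ₁ γ₂) * g γ₁ * g γ₂)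
    (h : (1 : ℂ) - (g γ : ℂ) ≠ 0) :
    KS B γ Ω g h γ = g γ ∧
      ∀ h' : (1 : ℂ) - ((KS B γ Ω g h γ : ℂˣ) : ℂ) ≠ 0,
        KS B γ (-Ω) (KS B γ Ω g h) h' = g := by
  have fixed : KS B γ Ω g h γ = g γ := by simp [KS, hBalt]
  refine ⟨fixed, fun h' => funext fun β => ?_⟩
  have base : Units.mk0 ((1 : ℂ) - ((KS B γ Ω g h γ : ℂˣ) : ℂ)) h' =
      Units.mk0 ((1 : ℂ) - (g γ : ℂ)) h := by
    ext
    simp [fixed]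
  change KS B γ Ω g h β * Units.mk0 _ h' ^ (-Ω * B β γ) = g β
  rw [base, KS, mul_assoc, ← zpow_add]
  simp
end
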